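/- Let α be a linear order and define g : List α → Option α by g([]) = none, g([a]) = some a, and g(a :: b :: l) = (if a = b then g(l) else some a). Then for every list l that is sorted in non-increasing order: g(l) = some x if and only if x occurs an odd number of times in l and every element of l greater than x occurs an even number of times in l; and g(l) = none if and only if every element of l occurs an even number of times. In other words, g computes the maximum element of odd multiplicity of l, i.e., the pivot of the 𝔽₂-chain represented by the multiset of entries of l. -/

import Mathlib

/-- The lazy-deduplication pivot extraction of the `CubeXorQueue`: repeatedly pop pairs of
equal maximal elements (which cancel modulo 2) until the two top elements differ, and
return the top element. -/
def getPivot {α : Type*} [DecidableEq α] : List α → Option α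
  | [] => none
  | [a] => some a
  | a :: b :: l => if a = b then getPivot l else some a

theorem count_cons_cons_self_even_iff {α : Type*} [DecidableEq α] (a y : α) (l : List α) :
    Even ((a :: a :: l).count y) ↔ Even (l.count y) := by
  simp only [List.count_cons]
  split_ifs <;> grind

theorem even_count_of_getPivot_eq_none {α : Type*} [DecidableEq α] (l : List α)
    (h : getPivot l = none) (y : α) : Even (l.count y) := by
  fun_induction getPivot l with
  | case1 => simp
  | case2 => simp at h
  | case3 a l ih => exact (count_cons_cons_self_even_iff a y l).2 (ih h)
  | case4 => simp at h

theorem odd_count_and_even_count_of_getPivot_eq_some {α : Type*} [LinearOrder α] (l : List α)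
    (hl : l.Pairwise (· ≥ ·)) (x : α) (h : getPivot l = some x) :
    Odd (l.count x) ∧ ∀ y, x < y → Even (l.count y) := by
  fun_induction getPivot l with
  | case1 => simp at h
  | case2 a =>
    obtain rfl : a = x := by simpa using h
    refine ⟨by simp, fun y hy => ?_⟩
    simp [hy.ne]
  | case3 a l ih =>
    simp only [← Nat.not_even_iff_odd, count_cons_cons_self_even_iff] at ih ⊢
    exact ih hl.of_cons.of_cons h
  | case4 a b l hab =>
    obtain rfl : a = x := by simpa using h
    simp only [List.pairwise_cons, List.mem_cons, forall_eq_or_imp] at hl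
    obtain ⟨⟨hba, hla⟩, hlb, -⟩ := hl
    have hb : b < a := lt_of_le_of_ne hba (Ne.symm hab)
    have ha : a ∉ b :: l := by
      simp only [List.mem_cons, not_or]
      exact ⟨hab, fun hm => (hlb a hm).not_gt hb⟩
    refine ⟨by rw [List.count_cons_self, List.count_eq_zero_of_not_mem ha]; simp,
      fun y hy => ?_⟩
    have hym : y ∉ a :: b :: l := by
      simp only [List.mem_cons, not_or]
      exact ⟨hy.ne', (hb.trans hy).ne', fun hm => (hla y hm).not_gt hy⟩
    rw [List.count_eq_zero_of_not_mem hym]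
    simp

/-- For a list `l` sorted in non-increasing order, `getPivot l = some x` iff `x` occurs an
odd number of times in `l` and every element of `l` greater than `x` occurs an even number
of times; and `getPivot l = none` iff every element of `l` occurs an even number of times.
That is, `getPivot` computes the maximum element of odd multiplicity — the pivot of the
`𝔽₂`-chain represented by the multiset of entries of `l`. -/
theorem getPivot_spec {α : Type*} [LinearOrder α] (l : List α)
    (hl : l.Pairwise (· ≥ ·)) :
    (∀ x : α, getPivot l = some x ↔
      Odd (l.count x) ∧ ∀ y ∈ l, x < y → Even (l.count y)) ∧
    (getPivot l = none ↔ ∀ y ∈ l, Even (l.count y)) := by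
  have mem_of_odd {y : α} (hy : Odd (l.count y)) : y ∈ l :=
    List.count_pos_iff.1 hy.pos
  cases h : getPivot l with
  | none =>
    have he := even_count_of_getPivot_eq_none l h
    refine ⟨fun x => ?_, by simp [he]⟩
    simp [← Nat.not_even_iff_odd, he]
  | some z =>
    obtain ⟨hz, hgt⟩ := odd_count_and_even_count_of_getPivot_eq_some l hl z h
    refine ⟨fun x => ⟨?_, ?_⟩, ?_⟩
    · rintro ⟨⟩
      exact ⟨hz, fun y _ => hgt y⟩
    · rintro ⟨hx, hxgt⟩
      rcases lt_trichotomy x z with hlt | rfl | hlt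
      · exact absurd (hxgt z (mem_of_odd hz) hlt) (Nat.not_even_iff_odd.2 hz)
      · rfl
      · exact absurd (hgt x hlt) (Nat.not_even_iff_odd.2 hx)
    · simp only [reduceCtorEq, false_iff]
      exact fun he => Nat.not_even_iff_odd.2 hz (he z (mem_of_odd hz))
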